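/- For any integer l ≥ 4, Σ_{l1≥2, l2,l3≥1, l1+l2+l3=l} (3^{l1-1}·2^{l2} - 2^{l1+l2-1} - 2^{l1-1}) · ζ(l1,l2,l3) = ((l-4)(l+1)/6)·ζ(l). -/

import Mathlib

/-- Riemann zeta value -/
noncomputable def rz (l : ℕ) : ℝ :=
  ∑' m : ℕ, if 0 < m then 1 / (m : ℝ) ^ l else 0

/-- double zeta value -/
noncomputable def dz (a b : ℕ) : ℝ :=
  ∑' p : ℕ × ℕ, if p.2 < p.1 ∧ 0 < p.2 then
    1 / ((p.1 : ℝ) ^ a * (p.2 : ℝ) ^ b) else 0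

/-- triple zeta value -/
noncomputable def tz (a b c : ℕ) : ℝ :=
  ∑' t : ℕ × ℕ × ℕ, if t.2.1 < t.1 ∧ t.2.2 < t.2.1 ∧ 0 < t.2.2 then
    1 / ((t.1 : ℝ) ^ a * (t.2.1 : ℝ) ^ b * (t.2.2 : ℝ) ^ c) else 0

/-- admissible triple indices of weight l -/
def TIdx (l : ℕ) : Finset (ℕ × ℕ × ℕ) :=
  (Finset.range (l + 1) ×ˢ Finset.range (l + 1) ×ˢ Finset.range (l + 1)).filter
    (fun t => 2 ≤ t.1 ∧ 1 ≤ t.2.1 ∧ 1 ≤ t.2.2 ∧ t.1 + t.2.1 + t.2.2 = l)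

open Finset Filter Topology

/-- The Seki–Yamamoto connector with a parameter `z`. -/
noncomputable def connector (z : ℝ) (a b : ℕ) : ℝ :=
  (∏ i ∈ range a, ((i : ℝ) + 1 - z)) * (∏ i ∈ range b, ((i : ℝ) + 1 - z)) /
    ∏ i ∈ range (a + b), ((i : ℝ) + 1 - z)

lemma prod_range_sub_pos {z : ℝ} (hz : z < 1) (a : ℕ) :
    0 < ∏ i ∈ range a, ((i : ℝ) + 1 - z) :=
  prod_pos fun i _ => by have : (0 : ℝ) ≤ i := i.cast_nonneg; linarith

lemma connector_pos {z : ℝ} (hz : z < 1) (a b : ℕ) : 0 < connector z a b :=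
  div_pos (mul_pos (prod_range_sub_pos hz a) (prod_range_sub_pos hz b)) (prod_range_sub_pos hz _)

lemma connector_comm (z : ℝ) (a b : ℕ) : connector z a b = connector z b a := by
  unfold connector
  rw [add_comm a b, mul_comm (∏ i ∈ range a, ((i : ℝ) + 1 - z))]

lemma connector_zero_right {z : ℝ} (hz : z < 1) (a : ℕ) : connector z a 0 = 1 := by
  unfold connector
  simp [div_self (prod_range_sub_pos hz a).ne']

lemma connector_zero_left {z : ℝ} (hz : z < 1) (b : ℕ) : connector z 0 b = 1 := by
  rw [connector_comm, connector_zero_right hz]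

lemma connector_succ_left {z : ℝ} (hz : z < 1) (a b : ℕ) :
    connector z (a + 1) b * ((a : ℝ) + b + 1 - z) = connector z a b * ((a : ℝ) + 1 - z) := by
  have h := (prod_range_sub_pos hz (a + b)).ne'
  have h' : (a : ℝ) + b + 1 - z ≠ 0 := by
    have : (0 : ℝ) ≤ a := a.cast_nonneg
    have : (0 : ℝ) ≤ b := b.cast_nonneg
    intro h0; linarith
  unfold connector
  rw [show a + 1 + b = a + b + 1 by ring, prod_range_succ, prod_range_succ _ (a + b)]
  push_cast
  field_simp

lemma connector_succ_right_le {z : ℝ} (hz : z < 1) (a b : ℕ) :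
    connector z a (b + 1) ≤ connector z a b := by
  have h := connector_succ_left hz b a
  rw [connector_comm z (b + 1), connector_comm z b] at h
  have h1 : (0 : ℝ) ≤ a := a.cast_nonneg
  have h2 : (0 : ℝ) ≤ b := b.cast_nonneg
  have h3 := connector_pos hz a (b + 1)
  nlinarith [mul_nonneg h3.le h1]

lemma connector_le {z : ℝ} (hz : z < 1) (a b : ℕ) :
    connector z a (b + 1) ≤ (1 - z) / ((a : ℝ) + 1 - z) := by
  induction b with
  | zero =>
    have h := connector_succ_left hz 0 a
    rw [connector_comm z (0 + 1), connector_zero_left hz] at h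
    have h1 : (0 : ℝ) ≤ a := a.cast_nonneg
    rw [le_div_iff₀ (by linarith)]
    push_cast at h
    simpa using h.le
  | succ b ih => exact (connector_succ_right_le hz a (b + 1)).trans ih

lemma tendsto_connector {z : ℝ} (hz : z < 1) (b : ℕ) :
    Tendsto (fun a => connector z a (b + 1)) atTop (𝓝 0) := by
  refine squeeze_zero (fun a => (connector_pos hz a _).le) (fun a => connector_le hz a b) ?_
  refine Tendsto.div_atTop tendsto_const_nhds ?_
  simp_rw [add_sub_assoc]
  exact tendsto_atTop_add_const_right _ _ tendsto_natCast_atTop_atTop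

lemma hasSum_connector {z : ℝ} (hz : z < 1) (n b : ℕ) (hb : 0 < b) :
    HasSum (fun a : ℕ => if n < a then 1 / ((a : ℝ) - z) * connector z a b else 0)
      (1 / (b : ℝ) * connector z n b) := by
  obtain ⟨b, rfl⟩ := Nat.exists_eq_succ_of_ne_zero hb.ne'
  have hinj : Function.Injective (fun k : ℕ => n + k + 1) := fun x y h => by
    simpa using h
  rw [← hinj.hasSum_iff]
  swap
  · intro x hx
    rw [if_neg]
    intro h
    exact hx ⟨x - n - 1, by simp only; omega⟩
  have key : ∀ k : ℕ,
      ((fun a : ℕ => if n < a then 1 / ((a : ℝ) - z) * connector z a (b + 1) else 0) ∘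
      fun k : ℕ => n + k + 1) k = 1 / ((b + 1 : ℕ) : ℝ) *
        (connector z (n + k) (b + 1) - connector z (n + (k + 1)) (b + 1)) := by
    intro k
    have h := connector_succ_left hz (n + k) (b + 1)
    have h1 : (0 : ℝ) ≤ n := n.cast_nonneg
    have h2 : (0 : ℝ) ≤ k := k.cast_nonneg
    have h3 : (0 : ℝ) ≤ b := b.cast_nonneg
    have h4 : (n : ℝ) + k + 1 - z ≠ 0 := by intro h0; linarith
    simp only [Function.comp]
    rw [if_pos (by omega), ← add_assoc n k 1]
    push_cast at h ⊢
    field_simp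
    linear_combination h
  rw [hasSum_iff_tendsto_nat_of_nonneg]
  · simp_rw [key, ← mul_sum, Finset.sum_range_sub' (fun k => connector z (n + k) (b + 1))]
    refine Tendsto.const_mul _ ?_
    have := (tendsto_connector hz b).comp (tendsto_add_atTop_nat n)
    simpa [Function.comp_def, add_comm n] using tendsto_const_nhds.sub this
  · intro k
    have h1 : (0 : ℝ) ≤ n := n.cast_nonneg
    have h2 : (0 : ℝ) ≤ k := k.cast_nonneg
    simp only [Function.comp]
    rw [if_pos (by omega)]
    have := connector_pos hz (n + k + 1) (b + 1)
    have h3 : (0 : ℝ) ≤ 1 / (((n + k + 1 : ℕ) : ℝ) - z) := by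
      push_cast
      exact div_nonneg zero_le_one (by linarith)
    positivity

open scoped ENNReal

lemma tsum_connector {z : ℝ} (hz : z < 1) (n b : ℕ) (hb : 0 < b) :
    ∑' a : ℕ, (if n < a then
      ENNReal.ofReal (1 / ((a : ℝ) - z)) * ENNReal.ofReal (connector z a b) else 0) =
      ENNReal.ofReal (1 / (b : ℝ)) * ENNReal.ofReal (connector z n b) := by
  have h := hasSum_connector hz n b hb
  rw [← ENNReal.ofReal_mul (by positivity), ← h.tsum_eq, ENNReal.ofReal_tsum_of_nonneg _ h.summable]
  · refine tsum_congr fun a => ?_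
    split_ifs with ha
    · have : (1 : ℝ) ≤ a := by exact_mod_cast (Nat.zero_le n).trans_lt ha
      rw [ENNReal.ofReal_mul (div_nonneg zero_le_one (by linarith))]
    · simp
  · intro a
    split_ifs with ha
    · have : (1 : ℝ) ≤ a := by exact_mod_cast (Nat.zero_le n).trans_lt ha
      exact mul_nonneg (div_nonneg zero_le_one (by linarith)) (connector_pos hz _ _).le
    · exact le_rfl

lemma tsum_triple_eq_tsum_single {z : ℝ} (hz : z < 1) :
    ∑' t : ℕ × ℕ × ℕ, (if t.2.1 < t.1 ∧ t.2.2 < t.2.1 ∧ 0 < t.2.2 then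
      ENNReal.ofReal (1 / (t.1 : ℝ)) * ENNReal.ofReal (1 / ((t.1 : ℝ) - z)) *
        ENNReal.ofReal (1 / ((t.2.1 : ℝ) - z)) * ENNReal.ofReal (1 / ((t.2.2 : ℝ) - z)) else 0) =
    ∑' b : ℕ, if 0 < b then
      ENNReal.ofReal (1 / (b : ℝ)) ^ 3 * ENNReal.ofReal (1 / ((b : ℝ) - z)) else 0 := by
  set g : ℕ → ℝ≥0∞ := fun a => ENNReal.ofReal (1 / ((a : ℝ) - z)) with hg
  set c : ℕ → ℕ → ℝ≥0∞ := fun a b => ENNReal.ofReal (connector z a b) with hc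
  set r : ℕ → ℝ≥0∞ := fun a => ENNReal.ofReal (1 / (a : ℝ)) with hr
  have hrow : ∀ n b : ℕ, 0 < b →
      ∑' a : ℕ, (if n < a then g a * c a b else 0) = r b * c n b :=
    fun n b hb => tsum_connector hz n b hb
  have hcol : ∀ m : ℕ, 0 < m → r m = ∑' b : ℕ, (if 0 < b then g b * c m b else 0) := by
    intro m hm
    have := tsum_connector hz 0 m hm
    rw [connector_zero_left hz, ENNReal.ofReal_one, mul_one] at this
    simp only [hr, ← this, hc, connector_comm z m, hg]
  calc _ = ∑' t : ℕ × ℕ × ℕ, ∑' b : ℕ, (if 0 < b then g b * (if 0 < t.2.2 then g t.2.2 *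
            (if t.2.2 < t.2.1 then g t.2.1 * (if t.2.1 < t.1 then g t.1 * c t.1 b else 0)
              else 0) else 0) else 0) := by
        refine tsum_congr fun t => ?_
        by_cases ht : t.2.1 < t.1 ∧ t.2.2 < t.2.1 ∧ 0 < t.2.2
        · rw [if_pos ht]
          obtain ⟨h1, h2, h3⟩ := ht
          change r t.1 * g t.1 * g t.2.1 * g t.2.2 = _
          rw [hcol t.1 (by omega), mul_assoc, mul_assoc, ← ENNReal.tsum_mul_right]
          refine tsum_congr fun b => ?_
          simp only [h1, h2, h3, if_true, ite_mul, zero_mul]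
          split_ifs <;> ring
        · rw [if_neg ht, eq_comm, ENNReal.tsum_eq_zero]
          intro b
          split_ifs <;> first | (exfalso; tauto) | simp
    _ = ∑' b : ℕ, ∑' m3 : ℕ, ∑' m2 : ℕ, ∑' m1 : ℕ, (if 0 < b then g b * (if 0 < m3 then g m3 *
            (if m3 < m2 then g m2 * (if m2 < m1 then g m1 * c m1 b else 0)
              else 0) else 0) else 0) := by
        rw [ENNReal.tsum_comm]
        refine tsum_congr fun b => ?_
        rw [ENNReal.tsum_prod']
        simp_rw [ENNReal.tsum_prod']
        rw [ENNReal.tsum_comm]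
        simp_rw [fun m2 => ENNReal.tsum_comm (f := fun m1 m3 : ℕ => if 0 < b then g b *
          (if 0 < m3 then g m3 * (if m3 < m2 then g m2 * (if m2 < m1 then g m1 * c m1 b else 0)
              else 0) else 0) else 0)]
        rw [ENNReal.tsum_comm]
    _ = _ := by
        refine tsum_congr fun b => ?_
        split_ifs with hb
        · have h1 : ∀ m3 : ℕ, ∑' m2 : ℕ, ∑' m1 : ℕ, g b * (if 0 < m3 then g m3 *
            (if m3 < m2 then g m2 * (if m2 < m1 then g m1 * c m1 b else 0)
              else 0) else 0) = g b * r b ^ 2 * (if 0 < m3 then g m3 * c m3 b else 0) := by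
            intro m3
            split_ifs with h3
            · simp_rw [ENNReal.tsum_mul_left]
              have h2 : ∀ m2 : ℕ, ∑' m1 : ℕ, (if m3 < m2 then g m2 *
                  (if m2 < m1 then g m1 * c m1 b else 0) else 0) =
                  r b * (if m3 < m2 then g m2 * c m2 b else 0) := by
                intro m2
                split_ifs with h2
                · rw [ENNReal.tsum_mul_left, hrow m2 b hb]; ring
                · simp
              simp_rw [h2, ENNReal.tsum_mul_left]
              rw [hrow m3 b hb]; ring
            · simp
          simp_rw [h1, ENNReal.tsum_mul_left]
          rw [hrow 0 b hb]
          simp only [hc, connector_zero_left hz, ENNReal.ofReal_one]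
          ring
        · simp

lemma tsum_pow_mul_tsum_pow (Z : ℝ≥0∞) (u v : ℕ → ℝ≥0∞) :
    (∑' i, Z ^ i * u i) * ∑' j, Z ^ j * v j =
      ∑' n, Z ^ n * ∑ p ∈ antidiagonal n, u p.1 * v p.2 := by
  rw [← ENNReal.tsum_mul_right]
  simp_rw [← ENNReal.tsum_mul_left]
  rw [← ENNReal.tsum_prod (f := fun i j => Z ^ i * u i * (Z ^ j * v j)),
    ← HasAntidiagonal.sigmaAntidiagonalEquivProd.tsum_eq
    (fun p : ℕ × ℕ => Z ^ p.1 * u p.1 * (Z ^ p.2 * v p.2)), ENNReal.tsum_sigma']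
  refine tsum_congr fun n => ?_
  rw [tsum_fintype, mul_sum, ← Finset.sum_coe_sort (antidiagonal n)]
  refine Finset.sum_congr rfl fun p _ => ?_
  have : p.1.1 + p.1.2 = n := mem_antidiagonal.mp p.2
  simp only [HasAntidiagonal.sigmaAntidiagonalEquivProd_apply]
  calc _ = Z ^ (p.1.1 + p.1.2) * (u p.1.1 * v p.1.2) := by rw [pow_add]; ring
    _ = _ := by rw [this]

lemma ofReal_one_div_sub {z : ℝ} (hz0 : 0 ≤ z) (hz : z < 1) {m : ℕ} (hm : 0 < m) :
    ENNReal.ofReal (1 / ((m : ℝ) - z)) =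
      ∑' k : ℕ, ENNReal.ofReal z ^ k * ENNReal.ofReal (1 / (m : ℝ) ^ (k + 1)) := by
  have hm1 : (1 : ℝ) ≤ m := by exact_mod_cast hm
  have h := (hasSum_geometric_of_lt_one (r := z / m) (by positivity)
    ((div_lt_one (by linarith)).2 (by linarith))).mul_left (1 / (m : ℝ))
  have h2 : 1 / (m : ℝ) * (1 - z / m)⁻¹ = 1 / ((m : ℝ) - z) := by
    have : (m : ℝ) - z ≠ 0 := by intro; linarith
    have : (m : ℝ) ≠ 0 := by intro; linarith
    field_simp
  rw [← h2, ← h.tsum_eq, ENNReal.ofReal_tsum_of_nonneg (fun n => by positivity) h.summable]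
  refine tsum_congr fun k => ?_
  rw [← ENNReal.ofReal_pow hz0, ← ENNReal.ofReal_mul (by positivity)]
  congr 1
  rw [div_pow, pow_succ]
  field_simp

/-- Single zeta value as an extended nonnegative real. -/
noncomputable def erz (l : ℕ) : ℝ≥0∞ :=
  ∑' m : ℕ, if 0 < m then ENNReal.ofReal (1 / (m : ℝ) ^ l) else 0

/-- Triple zeta value as an extended nonnegative real. -/
noncomputable def etz (a b c : ℕ) : ℝ≥0∞ :=
  ∑' t : ℕ × ℕ × ℕ, if t.2.1 < t.1 ∧ t.2.2 < t.2.1 ∧ 0 < t.2.2 then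
    ENNReal.ofReal (1 / ((t.1 : ℝ) ^ a * (t.2.1 : ℝ) ^ b * (t.2.2 : ℝ) ^ c)) else 0

lemma tsum_pow_etz {z : ℝ} (hz0 : 0 ≤ z) (hz : z < 1) :
    ∑' n, ENNReal.ofReal z ^ n * ∑ p ∈ antidiagonal n, ∑ q ∈ antidiagonal p.2,
      etz (p.1 + 2) (q.1 + 1) (q.2 + 1) = ∑' n, ENNReal.ofReal z ^ n * erz (n + 4) := by
  have h := tsum_triple_eq_tsum_single hz
  have hR : ∑' b : ℕ, (if 0 < b then
      ENNReal.ofReal (1 / (b : ℝ)) ^ 3 * ENNReal.ofReal (1 / ((b : ℝ) - z)) else 0) =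
      ∑' n, ENNReal.ofReal z ^ n * erz (n + 4) := by
    simp_rw [erz, ← ENNReal.tsum_mul_left]
    rw [ENNReal.tsum_comm]
    refine tsum_congr fun b => ?_
    split_ifs with hb
    · rw [ofReal_one_div_sub hz0 hz hb, ← ENNReal.tsum_mul_left]
      refine tsum_congr fun n => ?_
      rw [mul_left_comm, ← ENNReal.ofReal_pow (p := 1 / (b : ℝ)) (by positivity),
        ← ENNReal.ofReal_mul (by positivity)]
      congr 2
      rw [div_pow, one_pow, div_mul_div_comm, one_mul, ← pow_add]
      congr 2
      ring
    · simp
  rw [← hR, ← h]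
  simp_rw [etz]
  have h1 : ∀ n : ℕ, ∑ p ∈ antidiagonal n, ∑ q ∈ antidiagonal p.2,
      ∑' t : ℕ × ℕ × ℕ, (if t.2.1 < t.1 ∧ t.2.2 < t.2.1 ∧ 0 < t.2.2 then ENNReal.ofReal
        (1 / ((t.1 : ℝ) ^ (p.1 + 2) * (t.2.1 : ℝ) ^ (q.1 + 1) * (t.2.2 : ℝ) ^ (q.2 + 1))) else 0) =
      ∑' t : ℕ × ℕ × ℕ, ∑ p ∈ antidiagonal n, ∑ q ∈ antidiagonal p.2,
        (if t.2.1 < t.1 ∧ t.2.2 < t.2.1 ∧ 0 < t.2.2 then ENNReal.ofReal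
        (1 / ((t.1 : ℝ) ^ (p.1 + 2) * (t.2.1 : ℝ) ^ (q.1 + 1) * (t.2.2 : ℝ) ^ (q.2 + 1)))
          else 0) := by
    intro n
    rw [Summable.tsum_finsetSum fun _ _ => ENNReal.summable]
    refine sum_congr rfl fun p _ => ?_
    rw [Summable.tsum_finsetSum fun _ _ => ENNReal.summable]
  simp_rw [h1, ← ENNReal.tsum_mul_left]
  rw [ENNReal.tsum_comm]
  refine tsum_congr fun t => ?_
  by_cases ht : t.2.1 < t.1 ∧ t.2.2 < t.2.1 ∧ 0 < t.2.2
  · simp only [if_pos ht]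
    rw [ofReal_one_div_sub hz0 hz (m := t.1) (by omega),
      ofReal_one_div_sub hz0 hz (m := t.2.1) (by omega),
      ofReal_one_div_sub hz0 hz (m := t.2.2) (by omega), mul_assoc, mul_assoc,
      tsum_pow_mul_tsum_pow, tsum_pow_mul_tsum_pow, ← ENNReal.tsum_mul_left]
    refine tsum_congr fun n => ?_
    rw [mul_left_comm]
    congr 1
    rw [mul_sum]
    refine sum_congr rfl fun p _ => ?_
    rw [mul_sum, mul_sum]
    refine sum_congr rfl fun q _ => ?_
    rw [← ENNReal.ofReal_mul (by positivity), ← ENNReal.ofReal_mul (by positivity),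
      ← ENNReal.ofReal_mul (by positivity)]
    congr 1
    rw [pow_succ _ (p.1 + 1)]
    field_simp
  · simp [if_neg ht]

lemma eq_of_tsum_pow_eq {a b : ℕ → ℝ≥0∞}
    (h : ∀ z : ℝ, 0 ≤ z → z < 1 →
      ∑' n, ENNReal.ofReal z ^ n * a n = ∑' n, ENNReal.ofReal z ^ n * b n)
    (hfin : ∑' n, ENNReal.ofReal (1 / 2) ^ n * b n ≠ ∞) : a = b := by
  have hfa : ∑' n, ENNReal.ofReal (1 / 2) ^ n * a n ≠ ∞ := by
    rwa [h _ (by norm_num) (by norm_num)]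
  have aux : ∀ u : ℕ → ℝ≥0∞, ∑' n, ENNReal.ofReal (1 / 2) ^ n * u n ≠ ∞ →
      (∀ n, u n ≠ ∞) ∧ Summable (fun n => (1 / 2 : ℝ) ^ n * (u n).toReal) := by
    intro u hu
    refine ⟨fun n hn => ENNReal.ne_top_of_tsum_ne_top hu n ?_, ?_⟩
    · rw [hn, ENNReal.mul_top]
      exact pow_ne_zero _ (by simp)
    · refine (ENNReal.summable_toReal hu).congr fun n => ?_
      rw [ENNReal.toReal_mul, ENNReal.toReal_pow, ENNReal.toReal_ofReal (by norm_num)]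
  obtain ⟨ha, has⟩ := aux a hfa
  obtain ⟨hb, hbs⟩ := aux b hfin
  set c : ℕ → ℝ := fun n => (a n).toReal - (b n).toReal with hc
  have hval : ∀ z : ℝ, 0 ≤ z → z ≤ 1 / 2 → ∑' n, c n * z ^ n = 0 := by
    intro z hz hz2
    have key : ∀ u : ℕ → ℝ≥0∞, (∀ n, u n ≠ ∞) →
        Summable (fun n => (1 / 2 : ℝ) ^ n * (u n).toReal) →
        Summable (fun n => (u n).toReal * z ^ n) ∧
        ∑' n, (u n).toReal * z ^ n = (∑' n, ENNReal.ofReal z ^ n * u n).toReal := by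
      intro u hu hus
      have hs : Summable (fun n => (u n).toReal * z ^ n) := by
        refine Summable.of_nonneg_of_le (fun n => by positivity) (fun n => ?_) hus
        rw [mul_comm]
        gcongr
      refine ⟨hs, ?_⟩
      rw [← ENNReal.toReal_ofReal (tsum_nonneg fun n => by positivity :
        0 ≤ ∑' n, (u n).toReal * z ^ n), ENNReal.ofReal_tsum_of_nonneg
          (fun n => by positivity) hs]
      congr 1
      refine tsum_congr fun n => ?_
      rw [ENNReal.ofReal_mul (by positivity), ENNReal.ofReal_toReal (hu n),
        ENNReal.ofReal_pow hz, mul_comm]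
    obtain ⟨h1, h2⟩ := key a ha has
    obtain ⟨h3, h4⟩ := key b hb hbs
    simp_rw [hc, sub_mul]
    rw [h1.tsum_sub h3, h2, h4, h z hz (by linarith), sub_self]
  have hrad : 0 < (FormalMultilinearSeries.ofScalars ℝ c).radius := by
    refine lt_of_lt_of_le (b := ((1 / 2 : NNReal) : ℝ≥0∞)) (by simp) ?_
    refine FormalMultilinearSeries.le_radius_of_summable_norm _ ?_
    refine Summable.of_nonneg_of_le (fun n => by positivity) (fun n => ?_) (has.add hbs)
    rw [FormalMultilinearSeries.ofScalars_norm, hc, ← mul_add, mul_comm]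
    push_cast
    gcongr
    refine (norm_sub_le _ _).trans ?_
    simp
  have hps := (FormalMultilinearSeries.hasFPowerSeriesOnBall _ hrad).hasFPowerSeriesAt
  have hfreq : ∃ᶠ z in 𝓝[≠] (0 : ℝ), (FormalMultilinearSeries.ofScalars ℝ c).sum z = 0 := by
    have : ∀ᶠ z in 𝓝[>] (0 : ℝ), (FormalMultilinearSeries.ofScalars ℝ c).sum z = 0 := by
      filter_upwards [Ioc_mem_nhdsGT (show (0 : ℝ) < 1 / 2 by norm_num)] with z hz
      rw [← hval z hz.1.le hz.2]
      refine tsum_congr fun n => ?_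
      simp [mul_comm]
    exact this.frequently.filter_mono (nhdsWithin_mono _ fun x hx => ne_of_gt hx)
  have hev := hps.analyticAt.frequently_zero_iff_eventually_zero.mp hfreq
  have hzero := (hps.congr hev).eq_zero
  ext n
  have hn := congrArg (fun p => p.coeff n) hzero
  simp only [FormalMultilinearSeries.coeff_ofScalars] at hn
  have : c n = 0 := by simpa [FormalMultilinearSeries.coeff] using hn
  exact (ENNReal.toReal_eq_toReal_iff' (ha n) (hb n)).mp (sub_eq_zero.mp this)

lemma hasSum_rz {l : ℕ} (hl : 2 ≤ l) :
    HasSum (fun m : ℕ => if 0 < m then 1 / (m : ℝ) ^ l else 0) (rz l) := by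
  refine Summable.hasSum (Summable.of_nonneg_of_le (fun m => ?_) (fun m => ?_)
    (Real.summable_one_div_nat_pow.mpr (by omega : 1 < l)))
  · split_ifs <;> positivity
  · split_ifs
    · exact le_rfl
    · positivity

lemma erz_eq {l : ℕ} (hl : 2 ≤ l) : erz l = ENNReal.ofReal (rz l) := by
  rw [rz, ENNReal.ofReal_tsum_of_nonneg _ (hasSum_rz hl).summable, erz]
  · refine tsum_congr fun m => ?_
    split_ifs <;> simp
  · intro m
    split_ifs <;> positivity

lemma rz_nonneg (l : ℕ) : 0 ≤ rz l :=
  tsum_nonneg fun m => by split_ifs <;> positivity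

lemma rz_le_rz_two {l : ℕ} (hl : 2 ≤ l) : rz l ≤ rz 2 := by
  refine (hasSum_rz hl).summable.tsum_le_tsum (fun m => ?_) (hasSum_rz le_rfl).summable
  split_ifs with hm
  · have : (1 : ℝ) ≤ m := by exact_mod_cast hm
    gcongr
  · exact le_rfl

/-- The sum formula for triple zeta values. -/
lemma sum_etz (n : ℕ) : ∑ p ∈ antidiagonal n, ∑ q ∈ antidiagonal p.2,
      etz (p.1 + 2) (q.1 + 1) (q.2 + 1) = erz (n + 4) := by
  refine congrFun (eq_of_tsum_pow_eq (b := fun n => erz (n + 4))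
    (fun z hz0 hz => tsum_pow_etz hz0 hz) ?_) n
  refine ne_top_of_le_ne_top (b := ∑' n, ENNReal.ofReal (1 / 2) ^ n * ENNReal.ofReal (rz 2)) ?_ ?_
  · rw [ENNReal.tsum_mul_right, ENNReal.tsum_geometric]
    refine ENNReal.mul_ne_top ?_ ENNReal.ofReal_ne_top
    refine ENNReal.inv_ne_top.mpr (tsub_pos_of_lt ?_).ne'
    rw [ENNReal.ofReal_lt_one]
    norm_num
  · refine ENNReal.tsum_le_tsum fun n => ?_
    gcongr
    rw [erz_eq (by omega)]
    exact ENNReal.ofReal_le_ofReal (rz_le_rz_two (by omega))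

lemma etz_ne_top (i j k : ℕ) : etz (i + 2) (j + 1) (k + 1) ≠ ∞ := by
  have h := sum_etz (i + (j + k))
  rw [erz_eq (by omega)] at h
  refine ne_top_of_le_ne_top (ENNReal.ofReal_ne_top (r := rz (i + (j + k) + 4))) ?_
  rw [← h]
  refine le_trans ?_ (single_le_sum (f := fun p : ℕ × ℕ => ∑ q ∈ antidiagonal p.2,
      etz (p.1 + 2) (q.1 + 1) (q.2 + 1)) (fun _ _ => zero_le)
      (mem_antidiagonal.mpr rfl : (i, j + k) ∈ antidiagonal (i + (j + k))))
  exact (single_le_sum (f := fun q : ℕ × ℕ => etz (i + 2) (q.1 + 1) (q.2 + 1))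
    (fun _ _ => zero_le) (mem_antidiagonal.mpr rfl : (j, k) ∈ antidiagonal (j + k)))

lemma hasSum_tz (i j k : ℕ) :
    HasSum (fun t : ℕ × ℕ × ℕ => if t.2.1 < t.1 ∧ t.2.2 < t.2.1 ∧ 0 < t.2.2 then
      1 / ((t.1 : ℝ) ^ (i + 2) * (t.2.1 : ℝ) ^ (j + 1) * (t.2.2 : ℝ) ^ (k + 1)) else 0)
      (tz (i + 2) (j + 1) (k + 1)) := by
  refine Summable.hasSum ?_
  refine (ENNReal.summable_toReal (etz_ne_top i j k)).congr fun t => ?_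
  split_ifs
  · rw [ENNReal.toReal_ofReal (by positivity)]
  · simp

lemma etz_eq (i j k : ℕ) :
    etz (i + 2) (j + 1) (k + 1) = ENNReal.ofReal (tz (i + 2) (j + 1) (k + 1)) := by
  rw [tz, ENNReal.ofReal_tsum_of_nonneg _ (hasSum_tz i j k).summable, etz]
  · refine tsum_congr fun m => ?_
    split_ifs <;> simp
  · intro m
    split_ifs <;> positivity

/-- The sum formula for triple zeta values. -/
lemma sum_tz (n : ℕ) : ∑ p ∈ antidiagonal n, ∑ q ∈ antidiagonal p.2,
      tz (p.1 + 2) (q.1 + 1) (q.2 + 1) = rz (n + 4) := by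
  have hn : ∀ i j k, 0 ≤ tz i j k := fun i j k =>
    tsum_nonneg fun t => by split_ifs <;> positivity
  have h := sum_etz n
  simp_rw [etz_eq] at h
  rw [erz_eq (by omega)] at h
  simp_rw [← ENNReal.ofReal_sum_of_nonneg fun i _ => hn _ _ _] at h
  rw [← ENNReal.ofReal_sum_of_nonneg fun i _ => sum_nonneg fun _ _ => hn _ _ _] at h
  exact (ENNReal.ofReal_eq_ofReal_iff (sum_nonneg fun _ _ => sum_nonneg fun _ _ => hn _ _ _)
    (rz_nonneg _)).mp h

/-- The geometric expansion of `1 / (m - j X)`; it vanishes for `m = 0`. -/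
noncomputable def geomSeries (j m : ℕ) : PowerSeries ℝ :=
  PowerSeries.mk fun n => (j : ℝ) ^ n / (m : ℝ) ^ (n + 1)

lemma geomSeries_zero (j : ℕ) : geomSeries j 0 = 0 := by
  ext n
  simp [geomSeries]

lemma sub_mul_geomSeries (j : ℕ) {m : ℕ} (hm : 0 < m) :
    ((m : PowerSeries ℝ) - (j : PowerSeries ℝ) * PowerSeries.X) * geomSeries j m = 1 := by
  have hm' : (m : ℝ) ≠ 0 := by positivity
  have hc : ∀ k : ℕ, (k : PowerSeries ℝ) = PowerSeries.C (k : ℝ) := fun k => by simp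
  ext n
  rw [sub_mul, map_sub, hc m, hc j, PowerSeries.coeff_C_mul, mul_assoc, PowerSeries.coeff_C_mul]
  cases n with
  | zero => simp [geomSeries, hm']
  | succ n =>
    rw [PowerSeries.coeff_succ_X_mul, PowerSeries.coeff_one, if_neg (by omega)]
    simp only [geomSeries, PowerSeries.coeff_mk]
    field_simp
    ring

lemma geomSeries_mul (j k : ℕ) {a b : ℕ} (ha : 0 < a) (hb : 0 < b) :
    geomSeries j a * geomSeries k b =
      geomSeries (j + k) (a + b) * (geomSeries j a + geomSeries k b) := by
  have h1 := sub_mul_geomSeries j ha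
  have h2 := sub_mul_geomSeries k hb
  have h3 := sub_mul_geomSeries (j + k) (Nat.add_pos_left ha b)
  push_cast at h3
  set F := geomSeries j a
  set G := geomSeries k b
  set H := geomSeries (j + k) (a + b)
  linear_combination (-(F * G)) * h3 + H * G * h1 + H * F * h2

lemma sum_antidiagonal_pos_left {R : Type*} [AddCommMonoid R] (φ : ℕ → R) (M : ℕ) :
    ∑ p ∈ antidiagonal M, (if 0 < p.2 then φ p.1 else 0) = ∑ m ∈ range M, φ m := by
  rw [Nat.sum_antidiagonal_eq_sum_range_succ_mk, sum_range_succ]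
  simp only [Nat.sub_self, lt_irrefl, if_false, add_zero]
  refine sum_congr rfl fun m hm => ?_
  rw [if_pos (Nat.sub_pos_of_lt (mem_range.mp hm))]

lemma sum_antidiagonal_pos_right {R : Type*} [AddCommMonoid R] (φ : ℕ → R) (M : ℕ) :
    ∑ p ∈ antidiagonal M, (if 0 < p.1 then φ p.2 else 0) = ∑ m ∈ range M, φ m := by
  rw [← sum_antidiagonal_pos_left, ← Nat.sum_antidiagonal_swap]
  rfl

lemma sum_antidiagonal_mul_sum_range {R : Type*} [NonUnitalNonAssocSemiring R] (u v : ℕ → R)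
    (M : ℕ) :
    ∑ p ∈ antidiagonal M, u p.1 * ∑ k ∈ range p.2, v k =
      ∑ s ∈ range M, ∑ p ∈ antidiagonal s, u p.1 * v p.2 := by
  induction M with
  | zero => simp
  | succ M ih =>
    rw [Nat.sum_antidiagonal_succ', sum_range_succ, ← ih, ← sum_add_distrib]
    simp [sum_range_succ, mul_add]

lemma sum_antidiagonal_geomSeries (j k : ℕ) (G : ℕ → PowerSeries ℝ) (hG : G 0 = 0) (M : ℕ) :
    ∑ p ∈ antidiagonal M, geomSeries j p.1 * (geomSeries k p.2 * G p.2) =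
      geomSeries (j + k) M * (∑ m ∈ range M, geomSeries k m * G m +
        ∑ p ∈ antidiagonal M, geomSeries j p.1 * G p.2) := by
  rw [← sum_antidiagonal_pos_right, ← sum_add_distrib, mul_sum]
  refine sum_congr rfl fun p hp => ?_
  rw [← mem_antidiagonal.mp hp]
  rcases Nat.eq_zero_or_pos p.1 with h1 | h1
  · simp [h1, geomSeries_zero]
  rcases Nat.eq_zero_or_pos p.2 with h2 | h2
  · simp [h2, hG]
  rw [← mul_assoc, geomSeries_mul j k h1 h2, if_pos h1]
  ring

lemma sum_antidiagonal_geomSeries_mul (j : ℕ) (M : ℕ) :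
    ∑ p ∈ antidiagonal M, geomSeries j p.1 * geomSeries j p.2 =
      2 * (geomSeries (j + j) M * ∑ m ∈ range M, geomSeries j m) := by
  have h := sum_antidiagonal_geomSeries j j (fun m => if 0 < m then 1 else 0) (by simp) M
  have h1 : ∀ m, geomSeries j m * (if 0 < m then 1 else 0) = geomSeries j m := by
    intro m
    rcases Nat.eq_zero_or_pos m with rfl | hm
    · simp [geomSeries_zero]
    · simp [hm]
  simp_rw [h1, mul_ite, mul_one, mul_zero, sum_antidiagonal_pos_left] at h
  rw [h]
  ring

/-- Truncated generating series of triple zeta values. -/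
noncomputable def tripleSeries (N x y w : ℕ) : PowerSeries ℝ :=
  ∑ m ∈ range N, geomSeries x m *
    ∑ k ∈ range m, geomSeries y k * ∑ i ∈ range k, geomSeries w i

lemma sum_shuffle_two (N : ℕ) :
    ∑ M ∈ range N, ∑ p ∈ antidiagonal M, geomSeries 1 p.1 *
      (geomSeries 1 p.2 * ∑ k ∈ range p.2, geomSeries 1 k) =
      tripleSeries N 2 1 1 + 2 * tripleSeries N 2 2 1 := by
  unfold tripleSeries
  rw [mul_sum, ← sum_add_distrib]
  refine sum_congr rfl fun M _ => ?_
  rw [sum_antidiagonal_geomSeries 1 1 (fun m => ∑ k ∈ range m, geomSeries 1 k) (by simp),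
    sum_antidiagonal_mul_sum_range]
  simp_rw [sum_antidiagonal_geomSeries_mul, ← mul_sum]
  ring

lemma sum_shuffle_three (N : ℕ) :
    ∑ M ∈ range N, ∑ p ∈ antidiagonal M, geomSeries 1 p.1 *
      ∑ q ∈ antidiagonal p.2, geomSeries 1 q.1 * geomSeries 1 q.2 =
      6 * tripleSeries N 3 2 1 := by
  unfold tripleSeries
  rw [mul_sum]
  refine sum_congr rfl fun M _ => ?_
  simp_rw [sum_antidiagonal_geomSeries_mul, mul_left_comm _ (2 : PowerSeries ℝ), ← mul_sum]
  rw [sum_antidiagonal_geomSeries 1 2 (fun m => ∑ k ∈ range m, geomSeries 1 k) (by simp),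
    sum_antidiagonal_mul_sum_range]
  simp_rw [sum_antidiagonal_geomSeries_mul, ← mul_sum]
  ring

lemma sum_range_antidiagonal {R : Type*} [AddCommMonoid R] (Φ : ℕ → ℕ → R) (N : ℕ) :
    ∑ M ∈ range N, ∑ p ∈ antidiagonal M, Φ p.1 p.2 =
      ∑ a ∈ range N, ∑ b ∈ range N, if a + b < N then Φ a b else 0 := by
  rw [← sum_product' (f := fun a b => if a + b < N then Φ a b else 0), ← sum_filter,
    ← sum_fiberwise_of_maps_to (t := range N) (g := fun p : ℕ × ℕ => p.1 + p.2)]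
  · refine sum_congr rfl fun M hM => sum_congr ?_ fun _ _ => rfl
    ext p
    simp only [HasAntidiagonal.mem_antidiagonal, mem_filter, mem_product, mem_range] at hM ⊢
    omega
  · intro p hp
    exact mem_range.mpr (mem_filter.mp hp).2

/-- Sum over the cube `{0, …, N - 1}³`. -/
noncomputable def cubeSum (N : ℕ) (φ : ℕ → ℕ → ℕ → ℝ) : ℝ :=
  ∑ a ∈ range N, ∑ b ∈ range N, ∑ c ∈ range N, φ a b c

lemma cubeSum_swap_left (N : ℕ) (φ : ℕ → ℕ → ℕ → ℝ) :
    cubeSum N (fun a b c => φ b a c) = cubeSum N φ := sum_comm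

lemma cubeSum_swap_right (N : ℕ) (φ : ℕ → ℕ → ℕ → ℝ) :
    cubeSum N (fun a b c => φ a c b) = cubeSum N φ := sum_congr rfl fun _ _ => sum_comm

lemma cubeSum_add (N : ℕ) (φ ψ : ℕ → ℕ → ℕ → ℝ) :
    cubeSum N (fun a b c => φ a b c + ψ a b c) = cubeSum N φ + cubeSum N ψ := by
  simp [cubeSum, sum_add_distrib]

/-- Sum of a function over the permutations of its three arguments. -/
noncomputable def permSum (φ : ℕ → ℕ → ℕ → ℝ) (a b c : ℕ) : ℝ :=
  φ a b c + φ a c b + φ b a c + φ b c a + φ c a b + φ c b a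

lemma cubeSum_permSum (N : ℕ) (φ : ℕ → ℕ → ℕ → ℝ) :
    cubeSum N (permSum φ) = 6 * cubeSum N φ := by
  have h1 := cubeSum_swap_right N φ
  have h2 := cubeSum_swap_left N φ
  have h3 : cubeSum N (fun a b c => φ c a b) = cubeSum N φ :=
    (cubeSum_swap_right N (fun a b c => φ b a c)).trans h2
  have h4 : cubeSum N (fun a b c => φ b c a) = cubeSum N φ :=
    (cubeSum_swap_left N (fun a b c => φ a c b)).trans h1
  have h5 : cubeSum N (fun a b c => φ c b a) = cubeSum N φ :=
    (cubeSum_swap_left N (fun a b c => φ c a b)).trans h3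
  have : permSum φ = fun a b c =>
    φ a b c + φ a c b + φ b a c + φ b c a + φ c a b + φ c b a := rfl
  rw [this]
  simp only [cubeSum_add]
  rw [h1, h2, h3, h4, h5]
  ring

lemma mul_permSum {h : ℕ → ℕ → ℕ → ℝ} (hl : ∀ a b c, h b a c = h a b c)
    (hr : ∀ a b c, h a c b = h a b c) (φ : ℕ → ℕ → ℕ → ℝ) (a b c : ℕ) :
    h a b c * permSum φ a b c = permSum (fun a b c => h a b c * φ a b c) a b c := by
  have h1 := hr a b c
  have h2 := hl a b c
  have h3 : h c a b = h a b c := by rw [hl, hr]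
  have h4 : h b c a = h a b c := by rw [hr, hl]
  have h5 : h c b a = h a b c := by rw [hl, h4]
  simp only [permSum, h1, h2, h3, h4, h5]
  ring

open Classical in
/-- The weight comparing the shuffle, mixed and ordered regions of the cube with a third of its
diagonal. -/
noncomputable def regionWeight (N a b c : ℕ) : ℝ :=
  (if a + b + c < N then 1 / 3 else 0) - (if a + b < N ∧ c < b then 1 else 0) +
    (if b < a ∧ c < b then 1 else 0) - (if a = b ∧ b = c then 1 / 3 else 0)

open Classical in
/-- Indicator of the ordered triples on which the symmetrized region weight may be nonzero. -/
noncomputable def regionError (N a b c : ℕ) : ℝ :=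
  if (c ≤ b ∧ b ≤ a) ∧ N ≤ a + b + c ∧ (a + b < N ∨ N ≤ a + c) then 1 else 0

lemma regionError_nonneg (N a b c : ℕ) : 0 ≤ regionError N a b c := by
  unfold regionError; split_ifs <;> norm_num

lemma abs_permSum_regionWeight_le_of_sorted {N a b c : ℕ} (hcb : c ≤ b) (hba : b ≤ a)
    (ha : a < N) :
    |permSum (regionWeight N) a b c| ≤ 2 * regionError N a b c := by
  have key : permSum (regionWeight N) a b c =
      (if a + b + c < N then 2 else 0) - (if a = b ∧ b = c then 2 else 0)
      + (if b < a ∧ c < b then 1 else 0)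
      - (if a + b < N then ((if c < b then 1 else 0) + (if c < a then 1 else 0)) else 0)
      - (if a + c < N ∧ b < a then 1 else 0) := by
    have e1 : a + c + b = a + b + c := by omega
    have e3 : b + c + a = a + b + c := by omega
    have d1 : (a = c ∧ c = b) ↔ (a = b ∧ b = c) := by omega
    have d2 : (b = a ∧ a = c) ↔ (a = b ∧ b = c) := by omega
    have d3 : (b = c ∧ c = a) ↔ (a = b ∧ b = c) := by omega
    have d4 : (c = a ∧ a = b) ↔ (a = b ∧ b = c) := by omega
    have d5 : (c = b ∧ b = a) ↔ (a = b ∧ b = c) := by omega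
    simp only [permSum, regionWeight, e1, e3, d1, d2, d3, d4, d5, add_comm b a,
      add_comm c a, add_comm c b, hcb.not_gt, hba.not_gt, (hcb.trans hba).not_gt, and_false,
      false_and, if_false]
    by_cases h1 : a + b < N <;> by_cases h2 : c < b <;> by_cases h3 : c < a <;>
      by_cases h4 : b < a <;> simp only [h1, h2, h3, h4, and_true, and_false,
        if_true, if_false] <;> split_ifs <;> norm_num
  rw [key, regionError]
  simp only [hcb, hba, true_and]
  rcases hcb.eq_or_lt with rfl | h1
  · rcases hba.eq_or_lt with rfl | h2
    · simp only [lt_irrefl, and_false, if_false, and_self, if_true]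
      split_ifs <;> first | (exfalso; omega) | norm_num
    · simp only [lt_irrefl, and_false, if_false, h2, h2.ne', if_true, and_true]
      split_ifs <;> first | (exfalso; omega) | norm_num
  · rcases hba.eq_or_lt with rfl | h2
    · simp only [lt_irrefl, and_false, if_false, h1, h1.ne', if_true, and_true]
      split_ifs <;> first | (exfalso; omega) | norm_num
    · simp only [if_false, h1, h1.ne', h2, h2.ne', h1.trans h2, if_true, and_self,
        and_true]
      split_ifs <;> first | (exfalso; omega) | norm_num

lemma abs_permSum_regionWeight_le {N a b c : ℕ} (ha : a < N) (hb : b < N) (hc : c < N) :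
    |permSum (regionWeight N) a b c| ≤ 2 * permSum (regionError N) a b c := by
  have hS : ∀ {x y z : ℕ}, z ≤ y → y ≤ x → x < N →
      |permSum (regionWeight N) x y z| ≤ 2 * permSum (regionError N) x y z := by
    intro x y z h1 h2 h3
    refine (abs_permSum_regionWeight_le_of_sorted h1 h2 h3).trans ?_
    have := regionError_nonneg N
    have h4 := this x z y
    have h5 := this y x z
    have h6 := this y z x
    have h7 := this z x y
    have h8 := this z y x
    unfold permSum
    linarith
  rcases le_total a b with h1 | h1 <;> rcases le_total b c with h2 | h2 <;>
    rcases le_total a c with h3 | h3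
  · simpa only [permSum, add_comm, add_left_comm, add_assoc] using hS h1 h2 hc
  · simpa only [permSum, add_comm, add_left_comm, add_assoc] using hS h1 h2 hc
  · simpa only [permSum, add_comm, add_left_comm, add_assoc] using hS h3 h2 hb
  · simpa only [permSum, add_comm, add_left_comm, add_assoc] using hS h3 h1 hb
  · simpa only [permSum, add_comm, add_left_comm, add_assoc] using hS h1 h3 hc
  · simpa only [permSum, add_comm, add_left_comm, add_assoc] using hS h2 h3 ha
  · exact hS h2 h1 ha
  · exact hS h2 h1 ha

/-- The degree `n` part of `∏ 1 / (m - X)` over three integers `m`. -/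
noncomputable def prodCoeff (n a b c : ℕ) : ℝ :=
  PowerSeries.coeff n (geomSeries 1 a * (geomSeries 1 b * geomSeries 1 c))

lemma prodCoeff_swap_left (n a b c : ℕ) : prodCoeff n b a c = prodCoeff n a b c := by
  unfold prodCoeff; rw [mul_left_comm]

lemma prodCoeff_swap_right (n a b c : ℕ) : prodCoeff n a c b = prodCoeff n a b c := by
  unfold prodCoeff; rw [mul_comm (geomSeries 1 c)]

lemma prodCoeff_zero (n a b : ℕ) : prodCoeff n a b 0 = 0 := by
  simp [prodCoeff, geomSeries_zero]

lemma coeff_geomSeries_mul (n x y w a b c : ℕ) :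
    PowerSeries.coeff n (geomSeries x a * (geomSeries y b * geomSeries w c)) =
      ∑ p ∈ antidiagonal n, ∑ q ∈ antidiagonal p.2, (x : ℝ) ^ p.1 * (y : ℝ) ^ q.1 * (w : ℝ) ^ q.2 *
        (1 / ((a : ℝ) ^ (p.1 + 1) * (b : ℝ) ^ (q.1 + 1) * (c : ℝ) ^ (q.2 + 1))) := by
  rw [PowerSeries.coeff_mul]
  refine sum_congr rfl fun p _ => ?_
  rw [PowerSeries.coeff_mul, mul_sum]
  refine sum_congr rfl fun q _ => ?_
  simp only [geomSeries, PowerSeries.coeff_mk]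
  ring

lemma prodCoeff_eq (n a b c : ℕ) :
    prodCoeff n a b c = ∑ p ∈ antidiagonal n, ∑ q ∈ antidiagonal p.2,
      1 / ((a : ℝ) ^ (p.1 + 1) * (b : ℝ) ^ (q.1 + 1) * (c : ℝ) ^ (q.2 + 1)) := by
  simp [prodCoeff, coeff_geomSeries_mul]

lemma prodCoeff_nonneg (n a b c : ℕ) : 0 ≤ prodCoeff n a b c := by
  rw [prodCoeff_eq]
  positivity

lemma prodCoeff_le {n a b c : ℕ} (hn : 0 < n) (hc : 0 < c) (hcb : c ≤ b) (hba : b ≤ a) :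
    prodCoeff n a b c ≤ (∑ p ∈ antidiagonal n, ∑ _q ∈ antidiagonal p.2, (1 : ℝ)) *
      (1 / ((a : ℝ) * b * c * c)) := by
  rw [prodCoeff_eq, sum_mul]
  refine sum_le_sum fun p hp => ?_
  rw [sum_mul]
  refine sum_le_sum fun q hq => ?_
  have hc1 : (1 : ℝ) ≤ c := by exact_mod_cast hc
  have hcb' : (c : ℝ) ≤ b := by exact_mod_cast hcb
  have hba' : (b : ℝ) ≤ a := by exact_mod_cast hba
  have hc0 : (0 : ℝ) < c := by linarith
  have hb0 : (0 : ℝ) < b := by linarith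
  have ha0 : (0 : ℝ) < a := by linarith
  have hq' : q.1 + q.2 = p.2 := by simpa using hq
  have hp' : p.1 + p.2 = n := by simpa using hp
  have key : (c : ℝ) ≤ (a : ℝ) ^ p.1 * (b : ℝ) ^ q.1 * (c : ℝ) ^ q.2 := by
    calc (c : ℝ) = (c : ℝ) ^ 1 := (pow_one _).symm
      _ ≤ (c : ℝ) ^ (p.1 + q.1 + q.2) := pow_le_pow_right₀ hc1 (by omega)
      _ = (c : ℝ) ^ p.1 * (c : ℝ) ^ q.1 * (c : ℝ) ^ q.2 := by ring
      _ ≤ _ := by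
        gcongr
        exact hcb.trans hba
  rw [one_mul]
  refine one_div_le_one_div_of_le (by positivity) ?_
  calc (a : ℝ) * b * c * c ≤ (a : ℝ) * b * c * ((a : ℝ) ^ p.1 * (b : ℝ) ^ q.1 * (c : ℝ) ^ q.2) := by
        gcongr
    _ = _ := by ring

lemma sum_range_eq_sum_ite {f : ℕ → ℝ} {k N : ℕ} (h : k ≤ N) :
    ∑ i ∈ range k, f i = ∑ i ∈ range N, if i < k then f i else 0 := by
  rw [← sum_filter]
  refine sum_congr ?_ fun _ _ => rfl
  ext i
  simp only [mem_filter, mem_range]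
  omega

lemma coeff_tripleSeries_one (n N : ℕ) :
    PowerSeries.coeff n (tripleSeries N 1 1 1) =
      cubeSum N fun a b c => if b < a ∧ c < b then prodCoeff n a b c else 0 := by
  unfold tripleSeries cubeSum
  simp_rw [mul_sum, map_sum]
  refine sum_congr rfl fun a ha => ?_
  rw [sum_range_eq_sum_ite (mem_range.mp ha).le]
  refine sum_congr rfl fun b hb => ?_
  rw [sum_range_eq_sum_ite (mem_range.mp hb).le]
  split_ifs with h
  · simp [h, prodCoeff]
  · simp [h]

lemma coeff_shuffle_two (n N : ℕ) :
    PowerSeries.coeff n (tripleSeries N 2 1 1 + 2 * tripleSeries N 2 2 1) =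
      cubeSum N fun a b c => if a + b < N ∧ c < b then prodCoeff n a b c else 0 := by
  rw [← sum_shuffle_two]
  unfold cubeSum
  simp_rw [mul_sum, map_sum]
  change ∑ M ∈ range N, ∑ p ∈ antidiagonal M, ∑ c ∈ range p.2, prodCoeff n p.1 p.2 c = _
  rw [sum_range_antidiagonal (fun a b => ∑ c ∈ range b, prodCoeff n a b c)]
  refine sum_congr rfl fun a ha => sum_congr rfl fun b hb => ?_
  rw [sum_range_eq_sum_ite (mem_range.mp hb).le]
  split_ifs with h
  · simp [h]
  · simp [h]

lemma coeff_shuffle_three (n N : ℕ) :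
    PowerSeries.coeff n (6 * tripleSeries N 3 2 1) =
      cubeSum N fun a b c => if a + b + c < N then prodCoeff n a b c else 0 := by
  rw [← sum_shuffle_three]
  unfold cubeSum
  simp_rw [mul_sum, map_sum]
  change ∑ M ∈ range N, ∑ p ∈ antidiagonal M, ∑ q ∈ antidiagonal p.2, prodCoeff n p.1 q.1 q.2 = _
  rw [sum_range_antidiagonal (fun a m => ∑ q ∈ antidiagonal m, prodCoeff n a q.1 q.2)]
  refine sum_congr rfl fun a ha => ?_
  have h := sum_range_antidiagonal (fun b c => if a + b + c < N then prodCoeff n a b c else 0) N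
  trans ∑ b ∈ range N, ∑ c ∈ range N,
    if b + c < N then (if a + b + c < N then prodCoeff n a b c else 0) else 0
  · rw [← h]
    refine sum_congr rfl fun m _ => ?_
    have hm : ∀ q ∈ antidiagonal m, (if a + q.1 + q.2 < N then prodCoeff n a q.1 q.2 else 0) =
        if a + m < N then prodCoeff n a q.1 q.2 else 0 := by
      intro q hq
      rw [← HasAntidiagonal.mem_antidiagonal.mp hq, add_assoc]
    rw [sum_congr rfl hm]
    split_ifs <;> simp
  · refine sum_congr rfl fun b _ => sum_congr rfl fun c _ => ?_
    split_ifs <;> first | rfl | (exfalso; omega)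

lemma cubeSum_diagonal (n N : ℕ) :
    (cubeSum N fun a b c => if a = b ∧ b = c then prodCoeff n a b c else 0) =
      ∑ a ∈ range N, prodCoeff n a a a := by
  unfold cubeSum
  refine sum_congr rfl fun a ha => ?_
  rw [sum_eq_single a, sum_eq_single a]
  · simp
  · intro c _ hc
    simp [hc.symm]
  · exact fun h => absurd ha h
  · intro b _ hb
    simp [hb.symm]
  · exact fun h => absurd ha h

lemma cubeSum_mul_regionWeight (n N : ℕ) :
    (cubeSum N fun a b c => prodCoeff n a b c * regionWeight N a b c) =
      PowerSeries.coeff n (2 * tripleSeries N 3 2 1 - tripleSeries N 2 1 1 -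
        2 * tripleSeries N 2 2 1 + tripleSeries N 1 1 1) -
      (∑ a ∈ range N, prodCoeff n a a a) / 3 := by
  have hA := coeff_shuffle_three n N
  have hB := coeff_shuffle_two n N
  have hD := coeff_tripleSeries_one n N
  have hE := cubeSum_diagonal n N
  have e1 : 6 * tripleSeries N 3 2 1 = PowerSeries.C 3 * (2 * tripleSeries N 3 2 1) := by
    have : PowerSeries.C (3 : ℝ) = 3 := map_ofNat (PowerSeries.C (R := ℝ)) 3
    rw [this]; ring
  rw [e1, PowerSeries.coeff_C_mul] at hA
  rw [show (2 * tripleSeries N 3 2 1 - tripleSeries N 2 1 1 -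
        2 * tripleSeries N 2 2 1 + tripleSeries N 1 1 1) = 2 * tripleSeries N 3 2 1 -
        (tripleSeries N 2 1 1 + 2 * tripleSeries N 2 2 1) + tripleSeries N 1 1 1 by ring,
    map_add, map_sub, hB, hD, ← hE, ← mul_div_cancel_left₀ (PowerSeries.coeff n
      (2 * tripleSeries N 3 2 1)) (three_ne_zero' ℝ), hA]
  simp only [cubeSum, sum_div, ← sum_sub_distrib, ← sum_add_distrib]
  refine sum_congr rfl fun a _ => sum_congr rfl fun b _ => sum_congr rfl fun c _ => ?_
  rw [regionWeight]
  split_ifs <;> ring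

lemma sum_regionError_le (N b c : ℕ) : ∑ a ∈ range N, regionError N a b c ≤ 2 * c := by
  have h1 : ∀ a ∈ range N, regionError N a b c ≤
      (if a ∈ Ico (N - b - c) (N - b) then 1 else 0) + if a ∈ Ico (N - c) N then 1 else 0 := by
    intro a ha
    have ha' := mem_range.mp ha
    simp only [regionError, mem_Ico]
    split_ifs <;> first | (exfalso; omega) | norm_num
  refine (sum_le_sum h1).trans ?_
  have h2 : ∀ s : Finset ℕ, #s ≤ c → ∑ a ∈ range N, (if a ∈ s then (1 : ℝ) else 0) ≤ c := by
    intro s hs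
    rw [sum_boole]
    exact_mod_cast (card_le_card fun x hx => (mem_filter.mp hx).2).trans hs
  rw [sum_add_distrib, two_mul]
  refine add_le_add (h2 _ ?_) (h2 _ ?_) <;> rw [Nat.card_Ico] <;> omega

lemma prodCoeff_mul_regionError_le {n N : ℕ} (hn : 0 < n) {a b c : ℕ} (haN : a < N) :
    prodCoeff n a b c * regionError N a b c ≤
      (∑ p ∈ antidiagonal n, ∑ _q ∈ antidiagonal p.2, (1 : ℝ)) *
      (3 / N * (1 / ((b : ℝ) * c * c))) * regionError N a b c := by
  by_cases h : (c ≤ b ∧ b ≤ a) ∧ N ≤ a + b + c ∧ (a + b < N ∨ N ≤ a + c)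
  · refine mul_le_mul_of_nonneg_right ?_ (regionError_nonneg _ _ _ _)
    rcases Nat.eq_zero_or_pos c with rfl | hc
    · rw [prodCoeff_zero]
      positivity
    refine (prodCoeff_le hn hc h.1.1 h.1.2).trans ?_
    refine mul_le_mul_of_nonneg_left ?_ (by positivity)
    have hN : 0 < N := by omega
    have hb : 0 < b := by omega
    have ha : 0 < a := by omega
    have h3 : (N : ℝ) ≤ 3 * a := by exact_mod_cast (by omega : N ≤ 3 * a)
    rw [div_mul_div_comm, div_le_div_iff₀ (by positivity) (by positivity)]
    have : (0 : ℝ) ≤ (b : ℝ) * c * c := by positivity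
    nlinarith
  · simp [regionError, h]

lemma cubeSum_mul_regionError_le {n : ℕ} (hn : 0 < n) (N : ℕ) :
    (cubeSum N fun a b c => prodCoeff n a b c * regionError N a b c) ≤
      6 * (∑ p ∈ antidiagonal n, ∑ _q ∈ antidiagonal p.2, (1 : ℝ)) *
        ((∑ b ∈ range N, 1 / (b : ℝ)) ^ 2 / N) := by
  set K : ℝ := ∑ p ∈ antidiagonal n, ∑ _q ∈ antidiagonal p.2, (1 : ℝ)
  have hK : 0 ≤ K := by positivity
  unfold cubeSum
  have h0 : ∑ a ∈ range N, ∑ b ∈ range N, ∑ c ∈ range N,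
      prodCoeff n a b c * regionError N a b c ≤ ∑ a ∈ range N, ∑ b ∈ range N, ∑ c ∈ range N,
      K * (3 / N * (1 / ((b : ℝ) * c * c))) * regionError N a b c :=
    sum_le_sum fun a ha => sum_le_sum fun b _ => sum_le_sum fun c _ =>
      prodCoeff_mul_regionError_le hn (mem_range.mp ha)
  refine h0.trans ?_
  rw [sum_comm]
  simp_rw [fun b : ℕ => sum_comm (s := range N) (t := range N) (f := fun a c =>
    K * (3 / (N : ℝ) * (1 / ((b : ℝ) * c * c))) * regionError N a b c), ← mul_sum]
  have h1 : ∀ b c : ℕ, K * (3 / N * (1 / ((b : ℝ) * c * c))) * ∑ a ∈ range N, regionError N a b c ≤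
      6 * K / N * (1 / (b : ℝ) * (1 / c)) := by
    intro b c
    refine (mul_le_mul_of_nonneg_left (sum_regionError_le N b c) (by positivity)).trans ?_
    rcases Nat.eq_zero_or_pos c with rfl | hc
    · simp
    apply le_of_eq
    field_simp
    ring
  refine (sum_le_sum fun b _ => sum_le_sum fun c _ => h1 b c).trans (le_of_eq ?_)
  simp_rw [← mul_sum]
  rw [← sum_mul]
  ring

lemma tendsto_sum_one_div_sq_div :
    Tendsto (fun N : ℕ => (∑ b ∈ range N, 1 / (b : ℝ)) ^ 2 / N) atTop (𝓝 0) := by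
  have hle : ∀ N : ℕ, ∑ b ∈ range N, 1 / (b : ℝ) ≤ 1 + Real.log N := by
    intro N
    refine le_trans ?_ (harmonic_le_one_add_log N)
    rw [harmonic]
    push_cast
    cases N with
    | zero => simp
    | succ N =>
      rw [sum_range_succ']
      simp only [Nat.cast_zero, div_zero, add_zero, one_div]
      push_cast
      exact sum_le_sum_of_subset_of_nonneg (range_subset_range.mpr (by omega))
        fun _ _ _ => by positivity
  have h2 : Tendsto (fun N : ℕ => (1 + Real.log N) ^ 2 / (N : ℝ)) atTop (𝓝 0) := by
    have h3 : ∀ k : ℕ, Tendsto (fun N : ℕ => Real.log N ^ k / (N : ℝ)) atTop (𝓝 0) := fun k =>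
      ((Real.isLittleO_pow_log_id_atTop (n := k)).tendsto_div_nhds_zero).comp
        tendsto_natCast_atTop_atTop
    have h4 := ((h3 0).add ((h3 1).const_mul 2)).add (h3 2)
    simp only [mul_zero, add_zero] at h4
    refine h4.congr fun N => ?_
    ring
  refine squeeze_zero (fun N => by positivity) (fun N => ?_) h2
  have : (0 : ℝ) ≤ ∑ b ∈ range N, 1 / (b : ℝ) := by positivity
  gcongr
  exact hle N

lemma cubeSum_mono {N : ℕ} {φ ψ : ℕ → ℕ → ℕ → ℝ}
    (h : ∀ a < N, ∀ b < N, ∀ c < N, φ a b c ≤ ψ a b c) : cubeSum N φ ≤ cubeSum N ψ :=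
  sum_le_sum fun a ha => sum_le_sum fun b hb => sum_le_sum fun c hc =>
    h a (mem_range.mp ha) b (mem_range.mp hb) c (mem_range.mp hc)

lemma abs_cubeSum_le (N : ℕ) (φ : ℕ → ℕ → ℕ → ℝ) :
    |cubeSum N φ| ≤ cubeSum N fun a b c => |φ a b c| :=
  (abs_sum_le_sum_abs _ _).trans <| sum_le_sum fun _ _ =>
    (abs_sum_le_sum_abs _ _).trans <| sum_le_sum fun _ _ => abs_sum_le_sum_abs _ _

lemma cubeSum_const_mul (N : ℕ) (r : ℝ) (φ : ℕ → ℕ → ℕ → ℝ) :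
    (cubeSum N fun a b c => r * φ a b c) = r * cubeSum N φ := by
  simp [cubeSum, mul_sum]

lemma abs_cubeSum_mul_regionWeight_le (n N : ℕ) :
    |cubeSum N fun a b c => prodCoeff n a b c * regionWeight N a b c| ≤
      2 * cubeSum N fun a b c => prodCoeff n a b c * regionError N a b c := by
  have hsym := fun φ : ℕ → ℕ → ℕ → ℝ =>
    mul_permSum (prodCoeff_swap_left n) (prodCoeff_swap_right n) φ
  have h1 := cubeSum_permSum N fun a b c => prodCoeff n a b c * regionWeight N a b c
  have h2 := cubeSum_permSum N fun a b c => prodCoeff n a b c * regionError N a b c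
  have h3 := abs_cubeSum_le N (permSum fun a b c => prodCoeff n a b c * regionWeight N a b c)
  have h4 : (cubeSum N fun a b c =>
      |permSum (fun a b c => prodCoeff n a b c * regionWeight N a b c) a b c|) ≤
      cubeSum N fun a b c =>
        2 * permSum (fun a b c => prodCoeff n a b c * regionError N a b c) a b c := by
    refine cubeSum_mono fun a ha b hb c hc => ?_
    rw [← hsym, ← hsym, abs_mul, abs_of_nonneg (prodCoeff_nonneg _ _ _ _), mul_left_comm]
    exact mul_le_mul_of_nonneg_left (abs_permSum_regionWeight_le ha hb hc)
      (prodCoeff_nonneg _ _ _ _)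
  rw [cubeSum_const_mul, h2] at h4
  rw [h1, abs_mul, abs_of_nonneg (by norm_num : (0 : ℝ) ≤ 6)] at h3
  linarith

lemma tendsto_cubeSum_mul_regionWeight {n : ℕ} (hn : 0 < n) :
    Tendsto (fun N => cubeSum N fun a b c => prodCoeff n a b c * regionWeight N a b c)
      atTop (𝓝 0) := by
  rw [tendsto_zero_iff_abs_tendsto_zero]
  refine squeeze_zero (fun _ => abs_nonneg _) (fun N =>
    (abs_cubeSum_mul_regionWeight_le n N).trans
      (mul_le_mul_of_nonneg_left (cubeSum_mul_regionError_le hn N) zero_le_two)) ?_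
  simpa using (tendsto_sum_one_div_sq_div.const_mul
    (6 * ∑ p ∈ antidiagonal n, ∑ _q ∈ antidiagonal p.2, (1 : ℝ))).const_mul 2

lemma prodCoeff_self (n a : ℕ) :
    prodCoeff n a a a =
      ((n : ℝ) + 1) * (n + 2) / 2 * (if 0 < a then 1 / (a : ℝ) ^ (n + 3) else 0) := by
  have hcount : ∑ p ∈ antidiagonal n, ∑ _q ∈ antidiagonal p.2, (1 : ℝ) =
      ((n : ℝ) + 1) * (n + 2) / 2 := by
    simp only [sum_const, Nat.card_antidiagonal, nsmul_eq_mul, mul_one]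
    induction n with
    | zero => simp
    | succ n ih =>
      rw [Nat.sum_antidiagonal_succ, ih]
      push_cast
      ring
  rw [prodCoeff_eq, ← hcount, sum_mul]
  refine sum_congr rfl fun p hp => ?_
  rw [sum_mul]
  refine sum_congr rfl fun q hq => ?_
  have hq' : q.1 + q.2 = p.2 := by simpa using hq
  have hp' : p.1 + p.2 = n := by simpa using hp
  rcases Nat.eq_zero_or_pos a with rfl | ha
  · simp
  · rw [if_pos ha, one_mul, ← pow_add, ← pow_add]
    congr 2
    omega

lemma tendsto_sum_prodCoeff_self (n : ℕ) :
    Tendsto (fun N => ∑ a ∈ range N, prodCoeff n a a a) atTop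
      (𝓝 (((n : ℝ) + 1) * (n + 2) / 2 * rz (n + 3))) := by
  simp_rw [prodCoeff_self, ← mul_sum]
  exact (hasSum_rz (by omega)).tendsto_sum_nat.const_mul _

/-- Truncated triple zeta value. -/
noncomputable def truncatedTz (N a b c : ℕ) : ℝ :=
  ∑ m ∈ range N, ∑ k ∈ range m, ∑ i ∈ range k, 1 / ((m : ℝ) ^ a * (k : ℝ) ^ b * (i : ℝ) ^ c)

lemma coeff_tripleSeries (n N x y w : ℕ) :
    PowerSeries.coeff n (tripleSeries N x y w) =
      ∑ p ∈ antidiagonal n, ∑ q ∈ antidiagonal p.2, (x : ℝ) ^ p.1 * (y : ℝ) ^ q.1 * (w : ℝ) ^ q.2 *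
        truncatedTz N (p.1 + 1) (q.1 + 1) (q.2 + 1) := by
  unfold tripleSeries truncatedTz
  simp_rw [mul_sum, map_sum, coeff_geomSeries_mul]
  have hswap : ∀ (s : Finset ℕ) (f : ℕ → ℕ × ℕ → ℕ × ℕ → ℝ),
      ∑ m ∈ s, ∑ p ∈ antidiagonal n, ∑ q ∈ antidiagonal p.2, f m p q =
        ∑ p ∈ antidiagonal n, ∑ q ∈ antidiagonal p.2, ∑ m ∈ s, f m p q := by
    intro s f
    rw [sum_comm]
    exact sum_congr rfl fun p _ => sum_comm
  simp_rw [hswap]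

lemma tendsto_truncatedTz (i j k : ℕ) :
    Tendsto (fun N => truncatedTz N (i + 2) (j + 1) (k + 1)) atTop
      (𝓝 (tz (i + 2) (j + 1) (k + 1))) := by
  have hcube : Tendsto (fun N : ℕ => range N ×ˢ range N ×ˢ range N) atTop atTop := by
    refine tendsto_atTop_finset_of_monotone (fun M N h => ?_) fun t => ⟨t.1 + t.2.1 + t.2.2 + 1, ?_⟩
    · have := range_subset_range.mpr h
      exact product_subset_product this (product_subset_product this this)
    · simp only [mem_product, mem_range]
      omega
  refine ((hasSum_tz i j k).comp hcube).congr fun N => ?_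
  simp only [Function.comp, sum_product]
  refine sum_congr rfl fun a ha => ?_
  rw [sum_range_eq_sum_ite (mem_range.mp ha).le]
  refine sum_congr rfl fun b hb => ?_
  rw [sum_range_eq_sum_ite (mem_range.mp hb).le]
  split_ifs with h
  · refine sum_congr rfl fun c _ => ?_
    rcases Nat.eq_zero_or_pos c with rfl | hc
    · simp
    · simp [h, hc]
  · simp [h]

lemma sum_TIdx (n : ℕ) (F : ℕ → ℕ → ℕ → ℝ) :
    ∑ t ∈ TIdx (n + 4), F t.1 t.2.1 t.2.2 =
      ∑ p ∈ antidiagonal n, ∑ q ∈ antidiagonal p.2, F (p.1 + 2) (q.1 + 1) (q.2 + 1) := by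
  rw [sum_sigma']
  refine sum_bij' (i := fun t _ => ⟨(t.1 - 2, t.2.1 - 1 + (t.2.2 - 1)), (t.2.1 - 1, t.2.2 - 1)⟩)
    (j := fun s _ => (s.1.1 + 2, s.2.1 + 1, s.2.2 + 1)) ?_ ?_ ?_ ?_ ?_
  · rintro ⟨a, b, c⟩ ht
    simp only [TIdx, mem_filter, mem_product, mem_range, mem_sigma,
      HasAntidiagonal.mem_antidiagonal, and_true] at ht ⊢
    omega
  · rintro ⟨⟨a, m⟩, b, c⟩ hs
    simp only [TIdx, mem_filter, mem_product, mem_range, mem_sigma,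
      HasAntidiagonal.mem_antidiagonal] at hs ⊢
    omega
  · rintro ⟨a, b, c⟩ ht
    simp only [TIdx, mem_filter, mem_product, mem_range] at ht
    refine Prod.ext ?_ (Prod.ext ?_ ?_) <;> dsimp only <;> omega
  · rintro ⟨⟨a, m⟩, b, c⟩ hs
    simp only [mem_sigma, HasAntidiagonal.mem_antidiagonal] at hs
    obtain ⟨_, rfl⟩ := hs
    simp
  · rintro ⟨a, b, c⟩ ht
    simp only [TIdx, mem_filter, mem_product, mem_range] at ht
    simp only
    congr 1 <;> omega

theorem weighted_sum_formula_one (l : ℕ) (hl : 4 ≤ l) :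
    (∑ t ∈ TIdx l,
      ((3 : ℝ) ^ (t.1 - 1) * 2 ^ t.2.1 - 2 ^ (t.1 + t.2.1 - 1) - 2 ^ (t.1 - 1)) *
        tz t.1 t.2.1 t.2.2) =
      ((l : ℝ) - 4) * ((l : ℝ) + 1) / 6 * rz l := by
  obtain ⟨n, rfl⟩ := Nat.exists_eq_add_of_le' hl
  rw [sum_TIdx n fun a b c =>
    ((3 : ℝ) ^ (a - 1) * 2 ^ b - 2 ^ (a + b - 1) - 2 ^ (a - 1)) * tz a b c]
  set S : ℕ → PowerSeries ℝ := fun N => 2 * tripleSeries N 3 2 1 - tripleSeries N 2 1 1 -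
        2 * tripleSeries N 2 2 1 + tripleSeries N 1 1 1 with hS
  have hlim : Tendsto (fun N => PowerSeries.coeff (n + 1) (S N)) atTop
      (𝓝 (((n : ℝ) + 2) * (n + 3) / 6 * rz (n + 4))) := by
    have h := (tendsto_cubeSum_mul_regionWeight n.succ_pos).add
      ((tendsto_sum_prodCoeff_self (n + 1)).div_const 3)
    convert h using 1
    · ext N
      rw [Nat.succ_eq_add_one, cubeSum_mul_regionWeight]
      ring
    · push_cast
      congr 1
      ring
  have hcoeff : ∀ N, PowerSeries.coeff (n + 1) (S N) =
      ∑ p ∈ antidiagonal n, ∑ q ∈ antidiagonal p.2,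
        (2 * (3 : ℝ) ^ (p.1 + 1) * 2 ^ q.1 - 2 ^ (p.1 + 1) - 2 * 2 ^ (p.1 + 1) * 2 ^ q.1 + 1) *
          truncatedTz N (p.1 + 2) (q.1 + 1) (q.2 + 1) := by
    intro N
    have h2 : (2 : PowerSeries ℝ) = PowerSeries.C (2 : ℝ) :=
      (map_ofNat (PowerSeries.C (R := ℝ)) 2).symm
    simp only [hS, h2, map_add, map_sub, PowerSeries.coeff_C_mul, coeff_tripleSeries,
      mul_sum, ← sum_sub_distrib, ← sum_add_distrib]
    rw [Nat.sum_antidiagonal_succ, add_eq_right.mpr]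
    · refine sum_congr rfl fun p _ => sum_congr rfl fun q _ => ?_
      push_cast
      simp only [one_pow]
      ring
    · refine sum_eq_zero fun q _ => ?_
      push_cast
      simp only [one_pow, pow_zero]
      ring
  have hlim' : Tendsto (fun N => PowerSeries.coeff (n + 1) (S N)) atTop
      (𝓝 (∑ p ∈ antidiagonal n, ∑ q ∈ antidiagonal p.2,
        (2 * (3 : ℝ) ^ (p.1 + 1) * 2 ^ q.1 - 2 ^ (p.1 + 1) - 2 * 2 ^ (p.1 + 1) * 2 ^ q.1 + 1) *
          tz (p.1 + 2) (q.1 + 1) (q.2 + 1))) := by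
    simp_rw [hcoeff]
    exact tendsto_finsetSum _ fun p _ => tendsto_finsetSum _ fun q _ =>
      (tendsto_truncatedTz _ _ _).const_mul _
  have heq := tendsto_nhds_unique hlim' hlim
  have hsum := sum_tz n
  have hgoal : ∑ p ∈ antidiagonal n, ∑ q ∈ antidiagonal p.2,
      ((3 : ℝ) ^ (p.1 + 2 - 1) * 2 ^ (q.1 + 1) - 2 ^ (p.1 + 2 + (q.1 + 1) - 1) -
        2 ^ (p.1 + 2 - 1)) * tz (p.1 + 2) (q.1 + 1) (q.2 + 1) =
      ∑ p ∈ antidiagonal n, ∑ q ∈ antidiagonal p.2,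
        (2 * (3 : ℝ) ^ (p.1 + 1) * 2 ^ q.1 - 2 ^ (p.1 + 1) - 2 * 2 ^ (p.1 + 1) * 2 ^ q.1 + 1) *
          tz (p.1 + 2) (q.1 + 1) (q.2 + 1) -
      ∑ p ∈ antidiagonal n, ∑ q ∈ antidiagonal p.2, tz (p.1 + 2) (q.1 + 1) (q.2 + 1) := by
    simp only [← sum_sub_distrib]
    refine sum_congr rfl fun p _ => sum_congr rfl fun q _ => ?_
    rw [show p.1 + 2 - 1 = p.1 + 1 by omega,
      show p.1 + 2 + (q.1 + 1) - 1 = p.1 + 1 + q.1 + 1 by omega]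
    ring
  rw [hgoal, heq, hsum]
  push_cast
  ring
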